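/- Let (bₙ)_{n≥0} be a sequence of nonnegative real numbers. If the series Σ_{n≥0} aₙ bₙ converges for every sequence (aₙ)_{n≥0} of nonnegative real numbers satisfying limsup_{n→∞} aₙ^{1/n} ≤ 1 (equivalently, for every (aₙ) such that Σ aₙ zⁿ has radius of convergence at least 1), then there exist C > 0 and r ∈ (0,1) such that bₙ ≤ C rⁿ for all n ≥ 0. -/

import Mathlib

open Filter Topology

/-- A nonnegative sequence eventually dominated by `r ^ n` is dominated by `C * r ^ n` everywhere. -/
theorem exists_le_mul_pow_of_eventually_le {b : ℕ → ℝ} (hb : ∀ n, 0 ≤ b n) {r : ℝ} (hr : 0 < r)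
    (h : ∀ᶠ n in atTop, b n ≤ r ^ n) : ∃ C > (0 : ℝ), ∀ n, b n ≤ C * r ^ n := by
  have hO : b =O[atTop] fun n => r ^ n := by
    refine Asymptotics.IsBigO.of_bound 1 (h.mono fun n hn => ?_)
    rw [one_mul, Real.norm_of_nonneg (hb n), Real.norm_of_nonneg (pow_pos hr n).le]
    exact hn
  obtain ⟨C, hC, hbound⟩ := Asymptotics.bound_of_isBigO_nat_atTop hO
  refine ⟨C, hC, fun n => ?_⟩
  have hn := hbound (pow_pos hr n).ne'
  rwa [Real.norm_of_nonneg (hb n), Real.norm_of_nonneg (pow_pos hr n).le] at hn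

/-- if `Σ aₙ bₙ` converges for every nonnegative sequence `(aₙ)` whose power
series `Σ aₙ zⁿ` has radius of convergence at least 1 (i.e. `Σ aₙ xⁿ` converges for all
`0 ≤ x < 1`), then the nonnegative sequence `(bₙ)` decays geometrically. -/
theorem statement5 (b : ℕ → ℝ) (hb : ∀ n, 0 ≤ b n)
    (hconv : ∀ a : ℕ → ℝ, (∀ n, 0 ≤ a n) →
      (∀ x : ℝ, 0 ≤ x → x < 1 → Summable (fun n => a n * x ^ n)) →
      Summable (fun n => a n * b n)) :
    ∃ C > (0:ℝ), ∃ r ∈ Set.Ioo (0:ℝ) 1, ∀ n : ℕ, b n ≤ C * r ^ n := by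
  classical
  by_contra hcon
  have hfreq : ∀ r ∈ Set.Ioo (0 : ℝ) 1, ∃ᶠ n in atTop, r ^ n < b n := by
    intro r hr hev
    obtain ⟨C, hC, h⟩ := exists_le_mul_pow_of_eventually_le hb hr.1
      (hev.mono fun n hn => not_lt.1 hn)
    exact hcon ⟨C, hC, r, hr, h⟩
  obtain ⟨u, -, hu, hu_lim⟩ := exists_seq_strictMono_tendsto' (zero_lt_one' ℝ)
  obtain ⟨φ, hφ, hbφ⟩ := extraction_forall_of_frequently fun k => hfreq (u k) (hu k)
  let a : ℕ → ℝ := fun n => if n ∈ Set.range φ then (b n)⁻¹ else 0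
  have ha : ∀ n, 0 ≤ a n := by
    intro n
    dsimp only [a]
    split_ifs
    exacts [inv_nonneg.2 (hb n), le_rfl]
  have hsum : Summable fun n => a n * b n := by
    refine hconv a ha fun x hx0 hx1 => ?_
    obtain ⟨s, hxs, hs1⟩ := exists_between hx1
    have hs0 : 0 < s := hx0.trans_lt hxs
    obtain ⟨K, hK⟩ := eventually_atTop.1 (hu_lim.eventually (lt_mem_nhds hs1))
    refine Summable.of_norm_bounded_eventually_nat (g := fun n => (x / s) ^ n)
      (summable_geometric_of_lt_one (div_nonneg hx0 hs0.le) ((div_lt_one hs0).2 hxs)) ?_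
    filter_upwards [eventually_ge_atTop (φ K)] with n hn
    rw [Real.norm_of_nonneg (mul_nonneg (ha n) (pow_nonneg hx0 n))]
    by_cases hmem : n ∈ Set.range φ
    · obtain ⟨k, rfl⟩ := hmem
      have hsu : s ^ φ k ≤ b (φ k) :=
        (pow_le_pow_left₀ hs0.le (hK k (hφ.le_iff_le.1 hn)).le _).trans (hbφ k).le
      simp only [a, Set.mem_range_self, if_true, div_pow]
      rw [inv_mul_eq_div]
      gcongr
    · simp only [a, if_neg hmem, zero_mul]
      positivity
  have hone : ∀ k, a (φ k) * b (φ k) = 1 := fun k => by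
    simp only [a, Set.mem_range_self, if_true]
    exact inv_mul_cancel₀ ((pow_pos (hu k).1 _).trans (hbφ k)).ne'
  have hlim := hsum.tendsto_atTop_zero.comp hφ.tendsto_atTop
  simp only [Function.comp_def, hone] at hlim
  exact one_ne_zero (tendsto_nhds_unique tendsto_const_nhds hlim)
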